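/- arXiv:math/0603432 — 9 statements merged into one kernel-verified Lean document; each statement's English description precedes it below -/
import Mathlib

section
/- Let ω₁ and ω₂ be primitive alternating 2-forms on ℝ⁴ with ω₁ ≠ 0. If for every Lagrangian plane L one has (ω₁ restricted to L is zero) if and only if (ω₂ restricted to L is zero), then there exists a real constant c with ω₂ = c·ω₁. -/
noncomputable section

/-- `ℝ⁴` with coordinates `(q₁, q₂, p₁, p₂) = (x 0, x 1, x 2, x 3)`. -/
abbrev V : Type := Fin 4 → ℝ

/-- The complexification `ℂ⁴`. -/
abbrev Vc : Type := Fin 4 → ℂ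

/-- Standard basis of `ℝ⁴`: `e 0 = e_{q₁}`, `e 1 = e_{q₂}`, `e 2 = e_{p₁}`, `e 3 = e_{p₂}`. -/
def e (i : Fin 4) : V := Pi.single i 1

/-- Standard basis of `ℂ⁴`. -/
def ec (i : Fin 4) : Vc := Pi.single i 1

/-- The standard symplectic form `Ω = dq₁ ∧ dp₁ + dq₂ ∧ dp₂` on `ℝ⁴`. -/
def Omega : V → V → ℝ := fun x y => x 0 * y 2 - x 2 * y 0 + x 1 * y 3 - x 3 * y 1

/-- The complex bilinear extension of `Ω` to `ℂ⁴`. -/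
def OmegaC : Vc → Vc → ℂ := fun x y => x 0 * y 2 - x 2 * y 0 + x 1 * y 3 - x 3 * y 1

/-- Predicate: `ω` is an alternating (bilinear and antisymmetric) 2-form on `ℝ⁴`. -/
structure IsAlt2 (ω : V → V → ℝ) : Prop where
  add_left : ∀ x x' y, ω (x + x') y = ω x y + ω x' y
  smul_left : ∀ (c : ℝ) (x y : V), ω (c • x) y = c * ω x y
  antisymm : ∀ x y, ω x y = - ω y x

/-- Predicate: `θ` is a complex alternating (bilinear and antisymmetric) 2-form on `ℂ⁴`. -/
structure IsAlt2C (θ : Vc → Vc → ℂ) : Prop where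
  add_left : ∀ x x' y, θ (x + x') y = θ x y + θ x' y
  smul_left : ∀ (c : ℂ) (x y : Vc), θ (c • x) y = c * θ x y
  antisymm : ∀ x y, θ x y = - θ y x

section Wedge

variable {W : Type*} {k : Type*} [CommRing k]

/-- Wedge product of two 1-forms. -/
def wedge11 (a b : W → k) : W → W → k := fun x y => a x * b y - a y * b x

/-- Wedge product of a 1-form and a 2-form. -/
def wedge12 (a : W → k) (B : W → W → k) : W → W → W → k :=
  fun x y z => a x * B y z - a y * B x z + a z * B x y

/-- Wedge product of a 1-form and a 3-form. -/
def wedge13 (a : W → k) (C : W → W → W → k) : W → W → W → W → k :=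
  fun x y z w => a x * C y z w - a y * C x z w + a z * C x y w - a w * C x y z

/-- Wedge product of a 3-form and a 1-form. -/
def wedge31 (C : W → W → W → k) (a : W → k) : W → W → W → W → k :=
  fun x y z w => C x y z * a w - C x y w * a z + C x z w * a y - C y z w * a x

/-- Wedge product of two 2-forms. -/
def wedge22 (A B : W → W → k) : W → W → W → W → k :=
  fun x y z w =>
    A x y * B z w - A x z * B y w + A x w * B y z
      + A y z * B x w - A y w * B x z + A z w * B x y

end Wedge

/-- `⊥` of a 2-form on `ℝ⁴`: contraction with the bivector dual to `Ω`. -/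
def perpTwo (θ : V → V → ℝ) : ℝ := θ (e 0) (e 2) + θ (e 1) (e 3)

/-- `⊥` of a complex 2-form on `ℂ⁴`. -/
def perpTwoC (θ : Vc → Vc → ℂ) : ℂ := θ (ec 0) (ec 2) + θ (ec 1) (ec 3)

/-- `⊥` of a 3-form on `ℝ⁴`. -/
def perpThree (θ : V → V → V → ℝ) : V → ℝ := fun x => θ (e 0) (e 2) x + θ (e 1) (e 3) x

/-- A differential 1-form on `ℝ⁴` is smooth if its evaluation against any constant
vector field is smooth. -/
def Smooth1 (α : V → V → ℝ) : Prop := ∀ x, ContDiff ℝ (⊤ : ℕ∞) fun p => α p x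

/-- A differential 2-form on `ℝ⁴` is smooth if its evaluations against constant
vector fields are smooth. -/
def Smooth2 (ω : V → V → V → ℝ) : Prop := ∀ x y, ContDiff ℝ (⊤ : ℕ∞) fun p => ω p x y

/-- Exterior derivative of a differential 0-form (function), evaluated on a constant
vector field. -/
def d0 (f : V → ℝ) : V → V → ℝ := fun p x => fderiv ℝ f p x

/-- Exterior derivative of a differential 1-form, evaluated on constant vector fields. -/
def d1 (α : V → V → ℝ) : V → V → V → ℝ :=
  fun p x y => fderiv ℝ (fun q => α q y) p x - fderiv ℝ (fun q => α q x) p y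

/-- Exterior derivative of a differential 2-form, evaluated on constant vector fields. -/
def d2 (ω : V → V → V → ℝ) : V → V → V → V → ℝ :=
  fun p x y z =>
    fderiv ℝ (fun q => ω q y z) p x - fderiv ℝ (fun q => ω q x z) p y
      + fderiv ℝ (fun q => ω q x y) p z

/-- Exterior derivative of a differential 3-form, evaluated on constant vector fields. -/
def d3 (θ : V → V → V → V → ℝ) : V → V → V → V → V → ℝ :=
  fun p x y z w =>
    fderiv ℝ (fun q => θ q y z w) p x - fderiv ℝ (fun q => θ q x z w) p y
      + fderiv ℝ (fun q => θ q x y w) p z - fderiv ℝ (fun q => θ q x y z) p w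

/-- A mixed-degree complex form on `ℝ⁴`, given by its homogeneous components of
degree 0,1,2,3,4 (a degree-`k` component is recorded through its values on `k`-tuples
of complexified vectors). -/
structure Mixed where
  c0 : ℂ
  c1 : Vc → ℂ
  c2 : Vc → Vc → ℂ
  c3 : Vc → Vc → Vc → ℂ
  c4 : Vc → Vc → Vc → Vc → ℂ

namespace Mixed

instance : Zero Mixed := ⟨⟨0, 0, 0, 0, 0⟩⟩

instance : Add Mixed :=
  ⟨fun A B => ⟨A.c0 + B.c0, A.c1 + B.c1, A.c2 + B.c2, A.c3 + B.c3, A.c4 + B.c4⟩⟩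

instance : Neg Mixed := ⟨fun A => ⟨-A.c0, -A.c1, -A.c2, -A.c3, -A.c4⟩⟩

instance : SMul ℂ Mixed :=
  ⟨fun c A => ⟨c * A.c0, c • A.c1, c • A.c2, c • A.c3, c • A.c4⟩⟩

end Mixed

/-- A complex scalar, seen as a mixed form of degree 0. -/
def scalarM (c : ℂ) : Mixed := ⟨c, 0, 0, 0, 0⟩

/-- A complex 1-form, seen as a mixed form. -/
def oneM (α : Vc → ℂ) : Mixed := ⟨0, α, 0, 0, 0⟩

/-- A complex 2-form, seen as a mixed form. -/
def twoM (θ : Vc → Vc → ℂ) : Mixed := ⟨0, 0, θ, 0, 0⟩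

/-- Wedge product of mixed forms (degrees `> 4` vanish on `ℝ⁴`). -/
def wedgeM (A B : Mixed) : Mixed where
  c0 := A.c0 * B.c0
  c1 := fun x => A.c0 * B.c1 x + B.c0 * A.c1 x
  c2 := fun x y => A.c0 * B.c2 x y + B.c0 * A.c2 x y + wedge11 A.c1 B.c1 x y
  c3 := fun x y z => A.c0 * B.c3 x y z + B.c0 * A.c3 x y z
    + wedge12 A.c1 B.c2 x y z + wedge12 B.c1 A.c2 x y z
  c4 := fun x y z w => A.c0 * B.c4 x y z w + B.c0 * A.c4 x y z w
    + wedge13 A.c1 B.c3 x y z w + wedge31 A.c3 B.c1 x y z w + wedge22 A.c2 B.c2 x y z w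

/-- Interior product of a mixed form with a complexified vector `X`. -/
def iotaM (X : Vc) (A : Mixed) : Mixed :=
  ⟨A.c1 X, fun x => A.c2 X x, fun x y => A.c3 X x y, fun x y z => A.c4 X x y z, 0⟩

/-- The spin (Clifford) action `ρ(X + ξ)(θ) = ι_X θ + ξ ∧ θ` of `X + ξ ∈ (T ⊕ T*) ⊗ ℂ`
on mixed forms. -/
def rhoM (X : Vc) (ξ : Vc → ℂ) (A : Mixed) : Mixed := iotaM X A + wedgeM (oneM ξ) A

/-- Componentwise complex conjugation of a vector in `ℂ⁴`. -/
def cconj (x : Vc) : Vc := fun i => starRingEnd ℂ (x i)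

/-- Complex conjugation of a complex 2-form. -/
def conj2 (θ : Vc → Vc → ℂ) : Vc → Vc → ℂ :=
  fun x y => starRingEnd ℂ (θ (cconj x) (cconj y))

/-- Complex conjugation of a mixed form. -/
def conjM (A : Mixed) : Mixed where
  c0 := starRingEnd ℂ A.c0
  c1 := fun x => starRingEnd ℂ (A.c1 (cconj x))
  c2 := fun x y => starRingEnd ℂ (A.c2 (cconj x) (cconj y))
  c3 := fun x y z => starRingEnd ℂ (A.c3 (cconj x) (cconj y) (cconj z))
  c4 := fun x y z w => starRingEnd ℂ (A.c4 (cconj x) (cconj y) (cconj z) (cconj w))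

/-- Complex bilinear extension of a real 1-form on `ℝ⁴` to `ℂ⁴`. -/
def cx1 (α : V → ℝ) : Vc → ℂ := fun x => ∑ i, x i * (α (e i) : ℂ)

/-- Complex bilinear extension of a real 2-form on `ℝ⁴` to `ℂ⁴`. -/
def cx2 (ω : V → V → ℝ) : Vc → Vc → ℂ := fun x y => ∑ i, ∑ j, x i * y j * (ω (e i) (e j) : ℂ)

/-- `Θ = ω - iΩ`, as a complex 2-form on `ℂ⁴`. -/
def ThetaM (ω : V → V → ℝ) : Vc → Vc → ℂ :=
  fun x y => cx2 ω x y - Complex.I * OmegaC x y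

/-- `Φ = exp Θ = 1 + Θ + ½ Θ∧Θ`, as a mixed form. -/
def PhiM (ω : V → V → ℝ) : Mixed :=
  ⟨1, 0, ThetaM ω, 0, fun x y z w => (1 / 2 : ℂ) * wedge22 (ThetaM ω) (ThetaM ω) x y z w⟩

/-- Lie bracket of two vector fields on `ℝ⁴`. -/
def lieBracket (X Y : V → V) : V → V :=
  fun p => fderiv ℝ Y p (X p) - fderiv ℝ X p (Y p)

/-- The Nijenhuis tensor of a field `J` of endomorphisms of `ℝ⁴`, evaluated on two
vector fields: `N_J(X,Y) = [JX,JY] - J[JX,Y] - J[X,JY] + J²[X,Y]`. -/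
def nijenhuis (J : V → (V →ₗ[ℝ] V)) (X Y : V → V) : V → V :=
  fun p =>
    lieBracket (fun q => J q (X q)) (fun q => J q (Y q)) p
      - J p (lieBracket (fun q => J q (X q)) Y p)
      - J p (lieBracket X (fun q => J q (Y q)) p)
      + J p (J p (lieBracket X Y p))

namespace IsAlt2

variable {ω : V → V → ℝ}

theorem add_right (h : IsAlt2 ω) (x y y' : V) : ω x (y + y') = ω x y + ω x y' := by
  rw [h.antisymm, h.add_left, h.antisymm y, h.antisymm y']
  ring

theorem smul_right (h : IsAlt2 ω) (c : ℝ) (x y : V) : ω x (c • y) = c * ω x y := by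
  rw [h.antisymm, h.smul_left, h.antisymm y]
  ring

theorem self_eq_zero (h : IsAlt2 ω) (x : V) : ω x x = 0 := by
  linarith [h.antisymm x x]

/-- Expansion of an alternating form in Plücker coordinates. -/
theorem apply_eq (h : IsAlt2 ω) (x y : V) :
    ω x y = (x 0 * y 1 - x 1 * y 0) * ω (e 0) (e 1) + (x 0 * y 2 - x 2 * y 0) * ω (e 0) (e 2)
      + (x 0 * y 3 - x 3 * y 0) * ω (e 0) (e 3) + (x 1 * y 2 - x 2 * y 1) * ω (e 1) (e 2)
      + (x 1 * y 3 - x 3 * y 1) * ω (e 1) (e 3) + (x 2 * y 3 - x 3 * y 2) * ω (e 2) (e 3) := by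
  have expand (z : V) : z = z 0 • e 0 + z 1 • e 1 + z 2 • e 2 + z 3 • e 3 := by
    ext i
    fin_cases i <;> simp [e]
  conv_lhs => rw [expand x, expand y]
  simp only [h.add_left, h.add_right, h.smul_left, h.smul_right, h.self_eq_zero,
    h.antisymm (e 1) (e 0), h.antisymm (e 2) (e 0), h.antisymm (e 3) (e 0),
    h.antisymm (e 2) (e 1), h.antisymm (e 3) (e 1), h.antisymm (e 3) (e 2)]
  ring

/-- An alternating form vanishes on the span of `v` and `w` as soon as it vanishes on `(v, w)`. -/
theorem eq_zero_of_mem_span_pair (h : IsAlt2 ω) {v w : V} (hvw : ω v w = 0) {x y : V}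
    (hx : x ∈ Submodule.span ℝ {v, w}) (hy : y ∈ Submodule.span ℝ {v, w}) : ω x y = 0 := by
  obtain ⟨a, b, rfl⟩ := Submodule.mem_span_pair.1 hx
  obtain ⟨c, d, rfl⟩ := Submodule.mem_span_pair.1 hy
  simp [h.add_left, h.add_right, h.smul_left, h.smul_right, h.self_eq_zero, h.antisymm w v, hvw]

theorem eq_zero_of_not_linearIndependent (h : IsAlt2 ω) {v w : V}
    (hvw : ¬ LinearIndependent ℝ ![v, w]) : ω v w = 0 := by
  by_cases hv : v = 0
  · simpa [hv] using h.smul_left 0 0 w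
  · rw [LinearIndependent.pair_iff' hv] at hvw
    push Not at hvw
    obtain ⟨a, rfl⟩ := hvw
    rw [h.smul_right, h.self_eq_zero, mul_zero]

/-- A primitive form is `Ω`-traceless. -/
theorem apply_one_three_of_primitive (hp : ∀ x y z w : V, wedge22 ω Omega x y z w = 0) :
    ω (e 1) (e 3) = -ω (e 0) (e 2) := by
  have := hp (e 0) (e 1) (e 2) (e 3)
  simp [wedge22, Omega, e] at this
  simp only [e]
  linarith

end IsAlt2

theorem isAlt2_Omega : IsAlt2 Omega where
  add_left x x' y := by simp only [Omega, Pi.add_apply]; ring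
  smul_left c x y := by simp only [Omega, Pi.smul_apply, smul_eq_mul]; ring
  antisymm x y := by simp only [Omega]; ring

/-- Every point of the Lagrangian quadric is the Plücker vector of a pair of vectors. -/
theorem exists_plucker_of_quadric {p q r t s : ℝ} (h : p * q + r * t + s ^ 2 = 0) :
    ∃ v w : V, v 0 * w 1 - v 1 * w 0 = p ∧ v 2 * w 3 - v 3 * w 2 = q ∧
      v 0 * w 3 - v 3 * w 0 = r ∧ v 1 * w 2 - v 2 * w 1 = t ∧
      v 0 * w 2 - v 2 * w 0 = s ∧ v 1 * w 3 - v 3 * w 1 = -s := by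
  by_cases hp : p = 0
  · by_cases hr : r = 0
    · have hs : s = 0 := by simpa [hp, hr] using h
      by_cases hq : q = 0
      · exact ⟨![0, 1, 0, 0], ![0, 0, t, 0], by simp [hp, hq, hr, hs]⟩
      · exact ⟨![0, 0, 1, 0], ![0, -t, 0, q], by simp [hp, hr, hs]⟩
    · refine ⟨![1, -s / r, q / r, 0], ![0, p, s, r], ?_, ?_, ?_, ?_, ?_, ?_⟩ <;> simp <;>
        field_simp
      linarith
  · refine ⟨![1, 0, -t / p, s / p], ![0, p, s, r], ?_, ?_, ?_, ?_, ?_, ?_⟩ <;> simp <;>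
      field_simp
    linarith

/-- A linear form vanishing on the points of the quadric where another linear form does, the latter
having a nonzero first coefficient, is a multiple of it. -/
theorem proportional_on_quadric_of_ne_zero {a b c d f a' b' c' d' f' : ℝ}
    (H : ∀ p q r t s : ℝ, p * q + r * t + s ^ 2 = 0 →
      a * p + b * q + c * r + d * t + f * s = 0 → a' * p + b' * q + c' * r + d' * t + f' * s = 0)
    (ha : a ≠ 0) :
    ∃ k, a' = k * a ∧ b' = k * b ∧ c' = k * c ∧ d' = k * d ∧ f' = k * f := by
  obtain ⟨k, rfl⟩ : ∃ k, a' = k * a := ⟨a' / a, by field_simp⟩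
  have reduced (q r t s : ℝ) (h : a * (r * t + s ^ 2) = (b * q + c * r + d * t + f * s) * q) :
      (b' - k * b) * q + (c' - k * c) * r + (d' - k * d) * t + (f' - k * f) * s = 0 := by
    have hp : a * (-(b * q + c * r + d * t + f * s) / a) = -(b * q + c * r + d * t + f * s) := by
      field_simp
    have := H (-(b * q + c * r + d * t + f * s) / a) q r t s
      (mul_left_cancel₀ ha (by linear_combination q * hp + h)) (by linarith)
    linear_combination this - k * hp
  have h₁ := reduced 0 1 0 0 (by ring)
  have h₂ := reduced 0 0 1 0 (by ring)
  have h₃ := reduced 0 1 (-1) 1 (by ring)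
  have h₄ := reduced 1 ((d + 1) / a) (b + c * ((d + 1) / a)) 0 (by field_simp; ring)
  have hc : c' - k * c = 0 := by linarith
  have hd : d' - k * d = 0 := by linarith
  rw [hc, hd] at h₄
  exact ⟨k, rfl, by linarith, by linarith, by linarith, by linarith⟩

theorem proportional_on_quadric {a b c d f a' b' c' d' f' : ℝ}
    (H : ∀ p q r t s : ℝ, p * q + r * t + s ^ 2 = 0 →
      a * p + b * q + c * r + d * t + f * s = 0 → a' * p + b' * q + c' * r + d' * t + f' * s = 0)
    (hne : ¬ (a = 0 ∧ b = 0 ∧ c = 0 ∧ d = 0 ∧ f = 0)) :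
    ∃ k, a' = k * a ∧ b' = k * b ∧ c' = k * c ∧ d' = k * d ∧ f' = k * f := by
  by_cases ha : a = 0
  · by_cases hb : b = 0
    · by_cases hc : c = 0
      · by_cases hd : d = 0
        · have hf : f ≠ 0 := fun hf => hne ⟨ha, hb, hc, hd, hf⟩
          subst ha hb hc hd
          have h₁ := H 1 0 0 0 0 (by ring) (by ring)
          have h₂ := H 0 1 0 0 0 (by ring) (by ring)
          have h₃ := H 0 0 1 0 0 (by ring) (by ring)
          have h₄ := H 0 0 0 1 0 (by ring) (by ring)
          exact ⟨f' / f, by linarith, by linarith, by linarith, by linarith, by field_simp⟩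
        · obtain ⟨k, h₁, h₂, h₃, h₄, h₅⟩ := proportional_on_quadric_of_ne_zero
            (a := d) (b := c) (c := a) (d := b) (f := f)
            (a' := d') (b' := c') (c' := a') (d' := b') (f' := f')
            (fun p q r t s h h' => by linarith [H r t q p s (by linarith) (by linarith)]) hd
          exact ⟨k, h₃, h₄, h₂, h₁, h₅⟩
      · obtain ⟨k, h₁, h₂, h₃, h₄, h₅⟩ := proportional_on_quadric_of_ne_zero
          (a := c) (b := d) (c := a) (d := b) (f := f)
          (a' := c') (b' := d') (c' := a') (d' := b') (f' := f')
          (fun p q r t s h h' => by linarith [H r t p q s (by linarith) (by linarith)]) hc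
        exact ⟨k, h₃, h₄, h₁, h₂, h₅⟩
    · obtain ⟨k, h₁, h₂, h₃, h₄, h₅⟩ := proportional_on_quadric_of_ne_zero
        (a := b) (b := a) (c := c) (d := d) (f := f)
        (a' := b') (b' := a') (c' := c') (d' := d') (f' := f')
        (fun p q r t s h h' => by linarith [H q p r t s (by linarith) (by linarith)]) hb
      exact ⟨k, h₂, h₁, h₃, h₄, h₅⟩
  · exact proportional_on_quadric_of_ne_zero H ha

/-- two primitive 2-forms on ℝ⁴ vanishing on the same Lagrangian planes
are proportional. -/
theorem primitive_proportional_of_same_lagrangian_kernel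
    (ω₁ ω₂ : V → V → ℝ) (h₁ : IsAlt2 ω₁) (h₂ : IsAlt2 ω₂)
    (hp₁ : ∀ x y z w : V, wedge22 ω₁ Omega x y z w = 0)
    (hp₂ : ∀ x y z w : V, wedge22 ω₂ Omega x y z w = 0)
    (hne : ω₁ ≠ 0)
    (h : ∀ L : Submodule ℝ V, Module.finrank ℝ L = 2 →
      (∀ v ∈ L, ∀ w ∈ L, Omega v w = 0) →
      ((∀ v ∈ L, ∀ w ∈ L, ω₁ v w = 0) ↔ (∀ v ∈ L, ∀ w ∈ L, ω₂ v w = 0))) :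
    ∃ c : ℝ, ∀ x y : V, ω₂ x y = c * ω₁ x y := by
  have hpair (v w : V) (hΩ : Omega v w = 0) (hω : ω₁ v w = 0) : ω₂ v w = 0 := by
    by_cases hli : LinearIndependent ℝ ![v, w]
    · have hrank : Module.finrank ℝ (Submodule.span ℝ {v, w}) = 2 := by
        rw [← Matrix.range_cons_cons_empty v w ![], finrank_span_eq_card hli, Fintype.card_fin]
      exact (h _ hrank fun _ hx _ hy => isAlt2_Omega.eq_zero_of_mem_span_pair hΩ hx hy).1
        (fun _ hx _ hy => h₁.eq_zero_of_mem_span_pair hω hx hy)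
        v (Submodule.subset_span (by simp)) w (Submodule.subset_span (by simp))
    · exact h₂.eq_zero_of_not_linearIndependent hli
  have ht₁ := IsAlt2.apply_one_three_of_primitive hp₁
  have ht₂ := IsAlt2.apply_one_three_of_primitive hp₂
  obtain ⟨k, h01, h23, h03, h12, h02⟩ := proportional_on_quadric
    (a := ω₁ (e 0) (e 1)) (b := ω₁ (e 2) (e 3)) (c := ω₁ (e 0) (e 3)) (d := ω₁ (e 1) (e 2))
    (f := 2 * ω₁ (e 0) (e 2))
    (a' := ω₂ (e 0) (e 1)) (b' := ω₂ (e 2) (e 3)) (c' := ω₂ (e 0) (e 3)) (d' := ω₂ (e 1) (e 2))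
    (f' := 2 * ω₂ (e 0) (e 2))
    (fun p q r t s hquad hlin => by
      obtain ⟨v, w, hp, hq, hr, ht, hs, hs'⟩ := exists_plucker_of_quadric hquad
      have key := hpair v w (by simp only [Omega]; linarith)
        (by rw [h₁.apply_eq, hp, hq, hr, ht, hs, hs', ht₁]; linarith)
      rw [h₂.apply_eq, hp, hq, hr, ht, hs, hs', ht₂] at key
      linarith)
    (fun ⟨h01, h23, h03, h12, h02⟩ => hne <| by
      funext x y
      have h02' : ω₁ (e 0) (e 2) = 0 := by linarith
      rw [h₁.apply_eq, ht₁, h01, h23, h03, h12, h02']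
      simp)
  refine ⟨k, fun x y => ?_⟩
  have h02' : ω₂ (e 0) (e 2) = k * ω₁ (e 0) (e 2) := by linarith
  rw [h₁.apply_eq x y, h₂.apply_eq x y, ht₁, ht₂, h01, h23, h03, h12, h02']
  ring

end
end

section
/- Let ω₀ be a primitive alternating 2-form on ℝ⁴ and let A₀ be the endomorphism of ℝ⁴ defined by ω₀(X,Y) = Ω(A₀X,Y). Then A₀² = −pf(ω₀)·Id, where pf(ω₀) is the pfaffian of ω₀. -/
noncomputable section

/-- In Darboux coordinates, a linear map `A` for which `Ω(A·,·)` is antisymmetric, primitive and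
of pfaffian `c` squares to `-c`. -/
theorem sq_eq_of_darboux_coords (A : V →ₗ[ℝ] V) (c : ℝ)
    (hanti : ∀ i j, Omega (A (e i)) (e j) = -Omega (A (e j)) (e i))
    (hprim : Omega (A (e 0)) (e 2) + Omega (A (e 1)) (e 3) = 0)
    (hpf : Omega (A (e 0)) (e 2) * Omega (A (e 1)) (e 3)
      - Omega (A (e 0)) (e 1) * Omega (A (e 2)) (e 3)
      - Omega (A (e 0)) (e 3) * Omega (A (e 1)) (e 2) = c) (X : V) :
    A (A X) = (-c) • X := by
  have hexp : ∀ Y : V, A Y = ∑ i, Y i • A (e i) := fun Y => by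
    conv_lhs => rw [pi_eq_sum_univ' Y, map_sum]
    refine Finset.sum_congr rfl fun i _ => ?_
    rw [map_smul]
    congr 2
  have h00 := hanti 0 0
  have h01 := hanti 0 1
  have h02 := hanti 0 2
  have h03 := hanti 0 3
  have h11 := hanti 1 1
  have h12 := hanti 1 2
  have h13 := hanti 1 3
  have h22 := hanti 2 2
  have h23 := hanti 2 3
  have h33 := hanti 3 3
  rw [hexp (A X), hexp X]
  simp only [Fin.sum_univ_four]
  generalize A (e 0) = a at *
  generalize A (e 1) = b at *
  generalize A (e 2) = c' at *
  generalize A (e 3) = d at *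
  simp [Omega, e] at h00 h01 h02 h03 h11 h12 h13 h22 h23 h33 hprim hpf
  have ha2 : a 2 = 0 := by linarith
  have hb1 : b 1 = -a 0 := by linarith
  have hb2 : b 2 = -a 3 := by linarith
  have hb3 : b 3 = 0 := by linarith
  have hc0 : c' 0 = 0 := by linarith
  have hd0 : d 0 = -c' 1 := by linarith
  have hd1 : d 1 = 0 := by linarith
  have hd3 : d 3 = -a 0 := by linarith
  rw [hb1] at hpf
  subst hpf
  ext k
  fin_cases k <;>
    simp [ha2, hb1, hb2, hb3, hc0, hd0, hd1, hd3, ← h02, ← h03, ← h12] <;> ring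

/-- if `ω₀` is primitive and `ω₀(X,Y) = Ω(A₀X,Y)` then
`A₀² = -pf(ω₀)·Id`, where `ω₀∧ω₀ = pf(ω₀)·Ω∧Ω`. -/
theorem sq_of_primitive_tensor (ω₀ : V → V → ℝ) (h : IsAlt2 ω₀)
    (hprim : ∀ x y z w : V, wedge22 ω₀ Omega x y z w = 0)
    (A₀ : V →ₗ[ℝ] V) (hA : ∀ X Y : V, ω₀ X Y = Omega (A₀ X) Y)
    (pf : ℝ)
    (hpf : ∀ x y z w : V, wedge22 ω₀ ω₀ x y z w = pf * wedge22 Omega Omega x y z w) :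
    ∀ X : V, A₀ (A₀ X) = (-pf) • X := by
  refine sq_eq_of_darboux_coords A₀ pf (fun i j => ?_) ?_ ?_
  · rw [← hA, ← hA]
    exact h.antisymm _ _
  · have := hprim (e 0) (e 2) (e 1) (e 3)
    simp only [← hA]
    simp [wedge22, Omega, e] at this
    simp only [e]
    linarith
  · have := hpf (e 0) (e 2) (e 1) (e 3)
    simp only [← hA]
    have h21 := h.antisymm (e 2) (e 1)
    simp only [wedge22, h21] at this
    simp [Omega, e] at this
    simp only [e]
    linarith

end
end

section
/- Let ω = ω₀ + λΩ be an alternating 2-form on ℝ⁴ with ω₀ primitive and λ ∈ ℝ, and let A be the endomorphism of ℝ⁴ defined by ω(X,Y) = Ω(AX,Y). Then A² = 2λA − (λ² + pf(ω₀))·Id. -/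
noncomputable section

/-- An alternating 2-form on `ℝ⁴` is determined by its six coefficients. -/
lemma IsAlt2.apply_eq_s5 {ω : V → V → ℝ} (h : IsAlt2 ω) (x y : V) :
    ω x y = ω (e 0) (e 1) * (x 0 * y 1 - x 1 * y 0) + ω (e 0) (e 2) * (x 0 * y 2 - x 2 * y 0)
      + ω (e 0) (e 3) * (x 0 * y 3 - x 3 * y 0) + ω (e 1) (e 2) * (x 1 * y 2 - x 2 * y 1)
      + ω (e 1) (e 3) * (x 1 * y 3 - x 3 * y 1) + ω (e 2) (e 3) * (x 2 * y 3 - x 3 * y 2) := by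
  have expand (x : V) : x = x 0 • e 0 + x 1 • e 1 + x 2 • e 2 + x 3 • e 3 := by
    ext i
    fin_cases i <;> simp [e]
  have left (x y : V) : ω x y
      = x 0 * ω (e 0) y + x 1 * ω (e 1) y + x 2 * ω (e 2) y + x 3 * ω (e 3) y := by
    conv_lhs => rw [expand x]
    simp only [h.add_left, h.smul_left]
  have right (x y : V) : ω x y
      = y 0 * ω x (e 0) + y 1 * ω x (e 1) + y 2 * ω x (e 2) + y 3 * ω x (e 3) := by
    rw [h.antisymm, left, h.antisymm (e 0) x, h.antisymm (e 1) x, h.antisymm (e 2) x,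
      h.antisymm (e 3) x]
    ring
  have diag (x : V) : ω x x = 0 := by linarith [h.antisymm x x]
  rw [left, right (e 0), right (e 1), right (e 2), right (e 3)]
  simp only [diag, h.antisymm (e 1) (e 0), h.antisymm (e 2) (e 0), h.antisymm (e 3) (e 0),
    h.antisymm (e 2) (e 1), h.antisymm (e 3) (e 1), h.antisymm (e 3) (e 2)]
  ring

/-- if `ω = ω₀ + λΩ` with `ω₀` primitive and `ω(X,Y) = Ω(AX,Y)` then
`A² = 2λA - (λ² + pf(ω₀))·Id`. -/
theorem sq_of_tensor (ω₀ : V → V → ℝ) (h : IsAlt2 ω₀)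
    (hprim : ∀ x y z w : V, wedge22 ω₀ Omega x y z w = 0)
    (lam : ℝ) (pf : ℝ)
    (hpf : ∀ x y z w : V, wedge22 ω₀ ω₀ x y z w = pf * wedge22 Omega Omega x y z w)
    (A : V →ₗ[ℝ] V) (hA : ∀ X Y : V, ω₀ X Y + lam * Omega X Y = Omega (A X) Y) :
    ∀ X : V, A (A X) = (2 * lam) • A X - (lam ^ 2 + pf) • X := by
  have prim : ω₀ (e 1) (e 3) = -ω₀ (e 0) (e 2) := by
    have := hprim (e 0) (e 1) (e 2) (e 3)
    simp [wedge22, Omega, e] at this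
    simp only [e]
    linarith
  have pfaffian : pf = ω₀ (e 0) (e 2) * ω₀ (e 1) (e 3) - ω₀ (e 0) (e 1) * ω₀ (e 2) (e 3)
      - ω₀ (e 0) (e 3) * ω₀ (e 1) (e 2) := by
    have := hpf (e 0) (e 1) (e 2) (e 3)
    simp [wedge22, Omega, e] at this
    simp only [e]
    linarith
  have form := h.apply_eq_s5
  rw [prim] at pfaffian
  simp only [prim] at form
  generalize ω₀ (e 0) (e 1) = a, ω₀ (e 0) (e 2) = b, ω₀ (e 0) (e 3) = c,
    ω₀ (e 1) (e 2) = d, ω₀ (e 2) (e 3) = f at form pfaffian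
  have c0 (X : V) : A X 0 = (lam + b) * X 0 + d * X 1 - f * X 3 := by
    have := hA X (e 2)
    simp [form, Omega, e] at this
    linarith
  have c1 (X : V) : A X 1 = c * X 0 + (lam - b) * X 1 + f * X 2 := by
    have := hA X (e 3)
    simp [form, Omega, e] at this
    linarith
  have c2 (X : V) : A X 2 = a * X 1 + (lam + b) * X 2 + c * X 3 := by
    have := hA X (e 0)
    simp [form, Omega, e] at this
    linarith
  have c3 (X : V) : A X 3 = -a * X 0 + d * X 2 + (lam - b) * X 3 := by
    have := hA X (e 1)
    simp [form, Omega, e] at this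
    linarith
  intro X
  ext i
  fin_cases i <;> simp [c0, c1, c2, c3, pfaffian] <;> ring

end
end

section
/- Let ω = ω₀ + λΩ be an alternating 2-form on ℝ⁴ with ω₀ primitive and λ ∈ ℝ, and set B = λ·Id − A₀ where ω₀(X,Y) = Ω(A₀X,Y). Then for every 1-covector α on ℝ⁴ one has α∧ω = (α∘B)∧Ω, i.e. α∧ω − B*α∧Ω = 0. -/
noncomputable section

/-- Every covector on `ℝ⁴` is the contraction of `Ω` with some vector. -/
theorem exists_eq_Omega (α : V →ₗ[ℝ] ℝ) : ∃ X : V, ∀ v, α v = Omega X v := by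
  refine ⟨![α (e 2), α (e 3), -α (e 0), -α (e 1)], fun v => ?_⟩
  have hv : v = v 0 • e 0 + v 1 • e 1 + v 2 • e 2 + v 3 • e 3 := by
    ext i
    fin_cases i <;> simp [e]
  conv_lhs => rw [hv]
  simp only [map_add, map_smul, smul_eq_mul, Omega, Matrix.cons_val]
  ring

theorem Omega_antisymm (x y : V) : Omega x y = -Omega y x := by
  simp only [Omega]
  ring

/-- for `ω = ω₀ + λΩ` with `ω₀` primitive and `B = λ·Id - A₀`, every
1-covector `α` satisfies `α ∧ ω = (α∘B) ∧ Ω`. -/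
theorem wedge_omega_eq_Bstar_wedge_Omega (ω₀ : V → V → ℝ) (h : IsAlt2 ω₀)
    (hprim : ∀ x y z w : V, wedge22 ω₀ Omega x y z w = 0) (lam : ℝ)
    (A₀ : V →ₗ[ℝ] V) (hA : ∀ X Y : V, ω₀ X Y = Omega (A₀ X) Y)
    (B : V →ₗ[ℝ] V) (hB : ∀ v, B v = lam • v - A₀ v)
    (α : V →ₗ[ℝ] ℝ) :
    ∀ x y z : V,
      wedge12 (fun v => α v) (fun u v => ω₀ u v + lam * Omega u v) x y z
        = wedge12 (fun v => α (B v)) Omega x y z := by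
  intro x y z
  obtain ⟨X, hX⟩ := exists_eq_Omega α
  have hαA (v : V) : α (A₀ v) = ω₀ X v := by
    rw [hX, Omega_antisymm, ← hA, ← h.antisymm]
  have hp := hprim X x y z
  simp only [wedge22, ← hX] at hp
  simp only [wedge12, hB, map_sub, map_smul, smul_eq_mul, hαA]
  linear_combination hp

end
end

section
/- Let ω = ω₀ + λΩ be an alternating 2-form on ℝ⁴ with ω₀ primitive, B = λ·Id − A₀, Θ = ω − iΩ and Φ = exp(Θ) = 1 + Θ + ½Θ∧Θ. Then every real 1-covector α on ℝ⁴ decomposes as α = ½(α − i(α∘B))∧Φ + ½(α + i(α∘B))∧conj(Φ) in the complexified exterior algebra of (ℝ⁴)*. -/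
noncomputable section

theorem IsAlt2.diag {ω : V → V → ℝ} (h : IsAlt2 ω) (x : V) : ω x x = 0 := by
  linarith [h.antisymm x x]

/-- A primitive 2-form is annihilated by contraction with the bivector dual to `Ω`. -/
theorem perpTwo_eq_zero_of_primitive {ω₀ : V → V → ℝ}
    (hprim : ∀ x y z w : V, wedge22 ω₀ Omega x y z w = 0) : perpTwo ω₀ = 0 := by
  have h := hprim (e 0) (e 2) (e 1) (e 3)
  simp [wedge22, Omega, e] at h
  simpa [perpTwo, e] using h

/-- The values of `α ∘ A₀` on the standard basis in terms of those of `α` and `ω₀`. -/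
theorem apply_dual_endomorphism {ω₀ : V → V → ℝ} {A₀ : V →ₗ[ℝ] V}
    (hA : ∀ X Y : V, ω₀ X Y = Omega (A₀ X) Y) (α : V →ₗ[ℝ] ℝ) (v : V) :
    α (A₀ v) = ω₀ v (e 2) * α (e 0) + ω₀ v (e 3) * α (e 1)
      - ω₀ v (e 0) * α (e 2) - ω₀ v (e 1) * α (e 3) := by
  have hα : α (A₀ v) = ∑ i, A₀ v i * α (e i) := by
    conv_lhs => rw [pi_eq_sum_univ' (A₀ v)]
    simp [e, Pi.single]
  rw [hα, Fin.sum_univ_four]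
  simp [hA, Omega, e]

theorem conj_cx2 (ω : V → V → ℝ) (x y : Vc) :
    starRingEnd ℂ (cx2 ω (cconj x) (cconj y)) = cx2 ω x y := by
  simp [cx2, cconj]

theorem conj_OmegaC (x y : Vc) :
    starRingEnd ℂ (OmegaC (cconj x) (cconj y)) = OmegaC x y := by
  simp [OmegaC, cconj]

/-- Contracting `ω₀ ∧ Ω = 0` with the vector dual to `α` and adding `λ α ∧ Ω`. -/
theorem wedge12_comp_endomorphism {ω₀ : V → V → ℝ} (h : IsAlt2 ω₀)
    (hprim : ∀ x y z w : V, wedge22 ω₀ Omega x y z w = 0) {lam : ℝ}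
    {A₀ : V →ₗ[ℝ] V} (hA : ∀ X Y : V, ω₀ X Y = Omega (A₀ X) Y)
    {B : V →ₗ[ℝ] V} (hB : ∀ v, B v = lam • v - A₀ v)
    {ω : V → V → ℝ} (hω : ∀ x y, ω x y = ω₀ x y + lam * Omega x y)
    (α : V →ₗ[ℝ] ℝ) (x y z : Vc) :
    wedge12 (cx1 fun v => α v) (cx2 ω) x y z
      = wedge12 (cx1 fun v => α (B v)) OmegaC x y z := by
  have hp : ω₀ (e 1) (e 3) = -ω₀ (e 0) (e 2) := by
    have := perpTwo_eq_zero_of_primitive hprim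
    unfold perpTwo at this
    linarith
  have hαB (v : V) : α (B v) = lam * α v - α (A₀ v) := by simp [hB]
  have hΩ : ∀ i j, Omega (e i) (e j) = (!![0, 0, 1, 0; 0, 0, 0, 1; -1, 0, 0, 0; 0, -1, 0, 0] :
      Matrix (Fin 4) (Fin 4) ℝ) i j := by
    intro i j
    fin_cases i <;> fin_cases j <;> simp [Omega, e]
  simp only [wedge12, cx1, cx2, OmegaC, Fin.sum_univ_four, hαB, apply_dual_endomorphism hA, hω, hΩ,
    h.diag, h.antisymm (e 1) (e 0), h.antisymm (e 2) (e 0), h.antisymm (e 3) (e 0),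
    h.antisymm (e 2) (e 1), h.antisymm (e 3) (e 1), h.antisymm (e 3) (e 2), hp]
  simp
  ring

/-- with `Θ = ω - iΩ`, `Φ = exp Θ`, every real 1-covector decomposes as
`α = ½(α - i α∘B) ∧ Φ + ½(α + i α∘B) ∧ conj Φ`. -/
theorem one_covector_decomposition (ω₀ : V → V → ℝ) (h : IsAlt2 ω₀)
    (hprim : ∀ x y z w : V, wedge22 ω₀ Omega x y z w = 0) (lam : ℝ)
    (A₀ : V →ₗ[ℝ] V) (hA : ∀ X Y : V, ω₀ X Y = Omega (A₀ X) Y)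
    (B : V →ₗ[ℝ] V) (hB : ∀ v, B v = lam • v - A₀ v)
    (ω : V → V → ℝ) (hω : ∀ x y, ω x y = ω₀ x y + lam * Omega x y)
    (α : V →ₗ[ℝ] ℝ) :
    oneM (cx1 fun v => α v)
      = wedgeM (oneM fun x =>
            (1 / 2 : ℂ) * (cx1 (fun v => α v) x - Complex.I * cx1 (fun v => α (B v)) x))
          (PhiM ω)
        + wedgeM (oneM fun x =>
            (1 / 2 : ℂ) * (cx1 (fun v => α v) x + Complex.I * cx1 (fun v => α (B v)) x))
          (conjM (PhiM ω)) := by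
  have key := wedge12_comp_endomorphism h hprim hA hB hω α
  change Mixed.mk _ _ _ _ _ = Mixed.mk _ _ _ _ _
  congr 1
  · simp [wedgeM, oneM]
  · funext x
    simp [wedgeM, oneM, PhiM, conjM]
    ring
  · funext x y
    simp [wedgeM, oneM, PhiM, conjM, wedge11]
  · funext x y z
    have hk := key x y z
    simp only [wedge12] at hk
    simp [wedgeM, oneM, PhiM, conjM, wedge12, ThetaM, conj_cx2, conj_OmegaC]
    linear_combination -hk - (cx1 (fun v => α (B v)) x * OmegaC y z
      - cx1 (fun v => α (B v)) y * OmegaC x z + cx1 (fun v => α (B v)) z * OmegaC x y)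
      * Complex.I_sq
  · funext x y z w
    simp [wedgeM, oneM, PhiM, conjM, wedge13, wedge31, wedge22]
end
end

section
/- Let ω be an alternating 2-form on ℝ⁴, Θ = ω − iΩ and Φ = exp(Θ) = 1 + Θ + ½Θ∧Θ. Then for every complexified vector X ∈ ℂ⁴, ρ(X − ι_XΘ)(Φ) = 0; that is, the elements X − ι_XΘ of the eigenspace E annihilate Φ under the spin action. -/
noncomputable section

/-- Mixed forms are equal when their homogeneous components agree. -/
theorem Mixed.ext_components {A B : Mixed} (h0 : A.c0 = B.c0) (h1 : ∀ x, A.c1 x = B.c1 x)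
    (h2 : ∀ x y, A.c2 x y = B.c2 x y) (h3 : ∀ x y z, A.c3 x y z = B.c3 x y z)
    (h4 : ∀ x y z w, A.c4 x y z w = B.c4 x y z w) : A = B := by
  cases A
  cases B
  simp only [Mixed.mk.injEq]
  exact ⟨h0, funext h1, funext fun x => funext (h2 x),
    funext fun x => funext fun y => funext (h3 x y),
    funext fun x => funext fun y => funext fun z => funext (h4 x y z)⟩

/-- `ι_X (½ θ ∧ θ) = ι_X θ ∧ θ` for a 2-form `θ`. -/
theorem half_wedge22_self (θ : Vc → Vc → ℂ) (X x y z : Vc) :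
    (1 / 2 : ℂ) * wedge22 θ θ X x y z = wedge12 (θ X) θ x y z := by
  simp only [wedge22, wedge12]
  ring

/-- for every complexified vector `X`, the element `X - ι_XΘ` of the
eigenspace `E` annihilates `Φ = exp(ω - iΩ)` under the spin action. -/
theorem spin_annihilates_Phi (ω : V → V → ℝ) (hω : IsAlt2 ω) (X : Vc) :
    rhoM X (fun y => -(ThetaM ω X y)) (PhiM ω) = 0 := by
  apply Mixed.ext_components
  · change (0 : ℂ) + 0 * 1 = 0
    ring
  · intro x
    change ThetaM ω X x + (0 * 0 + 1 * -(ThetaM ω X x)) = 0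
    ring
  · intro x y
    change (0 : ℂ) + (0 * ThetaM ω x y + 1 * 0
      + (-(ThetaM ω X x) * 0 - -(ThetaM ω X y) * 0)) = 0
    ring
  · intro x y z
    change (1 / 2 : ℂ) * wedge22 (ThetaM ω) (ThetaM ω) X x y z
      + (0 * 0 + 1 * 0 + wedge12 (fun y => -(ThetaM ω X y)) (ThetaM ω) x y z
        + wedge12 (fun _ => 0) (fun _ _ => 0) x y z) = 0
    rw [half_wedge22_self]
    simp only [wedge12]
    ring
  · intro x y z w
    change (0 : ℂ) + (0 * ((1 / 2 : ℂ) * wedge22 (ThetaM ω) (ThetaM ω) x y z w) + 1 * 0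
      + wedge13 (fun y => -(ThetaM ω X y)) (fun _ _ _ => 0) x y z w
      + wedge31 (fun _ _ _ => 0) (fun _ => 0) x y z w
      + wedge22 (fun _ _ => 0) (ThetaM ω) x y z w) = 0
    simp only [wedge13, wedge31, wedge22]
    ring

end
end

section
/- Let ω be an alternating 2-form on ℝ⁴, Θ = ω − iΩ and Φ = exp(Θ) = 1 + Θ + ½Θ∧Θ. Then for every complexified vector X ∈ ℂ⁴, ρ(X − ι_X conj(Θ))(Φ) = −2i·(ι_XΩ)∧Φ. In particular the image of Λ¹(conj(E)) under the spin action applied to Φ is exactly the set of forms α∧Φ with α a complex 1-covector. -/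
noncomputable section

/-- The bilinear extension of a real 2-form is a real form. -/
theorem conj2_cx2 (ω : V → V → ℝ) : conj2 (cx2 ω) = cx2 ω := by
  funext x y
  simp [conj2, cx2, cconj]

theorem conj2_ThetaM (ω : V → V → ℝ) (x y : Vc) :
    conj2 (ThetaM ω) x y = ThetaM ω x y + 2 * Complex.I * OmegaC x y := by
  have h := congrFun₂ (conj2_cx2 ω) x y
  simp only [conj2] at h
  simp only [conj2, ThetaM, map_sub, h]
  simp [OmegaC, cconj]
  ring

/-- The wedge product with a 1-form is homogeneous in the 1-form. -/
theorem smul_wedgeM_oneM (c : ℂ) (α : Vc → ℂ) (A : Mixed) :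
    c • wedgeM (oneM α) A = wedgeM (oneM fun x => c * α x) A := by
  apply Mixed.ext_components
  · change c * (0 * A.c0) = 0 * A.c0
    ring
  · intro x
    change c * (0 * A.c1 x + A.c0 * α x) = 0 * A.c1 x + A.c0 * (c * α x)
    ring
  · intro x y
    change c * (0 * A.c2 x y + A.c0 * 0 + wedge11 α A.c1 x y)
      = 0 * A.c2 x y + A.c0 * 0 + wedge11 (fun x => c * α x) A.c1 x y
    simp only [wedge11]
    ring
  · intro x y z
    change c * (0 * A.c3 x y z + A.c0 * 0 + wedge12 α A.c2 x y z + wedge12 A.c1 0 x y z)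
      = 0 * A.c3 x y z + A.c0 * 0 + wedge12 (fun x => c * α x) A.c2 x y z + wedge12 A.c1 0 x y z
    simp only [wedge12, Pi.zero_apply]
    ring
  · intro x y z w
    change c * (0 * A.c4 x y z w + A.c0 * 0 + wedge13 α A.c3 x y z w + wedge31 0 A.c1 x y z w
        + wedge22 0 A.c2 x y z w)
      = 0 * A.c4 x y z w + A.c0 * 0 + wedge13 (fun x => c * α x) A.c3 x y z w
        + wedge31 0 A.c1 x y z w + wedge22 0 A.c2 x y z w
    simp only [wedge13, wedge31, wedge22, Pi.zero_apply]
    ring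

/-- The spin action of `X + ξ` on `Φ = exp Θ` is the wedge product of `ι_X Θ + ξ` with `Φ`. -/
theorem rhoM_PhiM (ω : V → V → ℝ) (X : Vc) (ξ : Vc → ℂ) :
    rhoM X ξ (PhiM ω) = wedgeM (oneM fun y => ThetaM ω X y + ξ y) (PhiM ω) := by
  apply Mixed.ext_components
  · change (0 : ℂ) + 0 * 1 = 0 * 1
    ring
  · intro x
    change ThetaM ω X x + (0 * 0 + 1 * ξ x) = 0 * 0 + 1 * (ThetaM ω X x + ξ x)
    ring
  · intro x y
    change (0 : ℂ) + (0 * ThetaM ω x y + 1 * 0 + wedge11 ξ 0 x y)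
      = 0 * ThetaM ω x y + 1 * 0 + wedge11 (fun y => ThetaM ω X y + ξ y) 0 x y
    simp [wedge11]
  · intro x y z
    change (1 / 2 : ℂ) * wedge22 (ThetaM ω) (ThetaM ω) X x y z
        + (0 * 0 + 1 * 0 + wedge12 ξ (ThetaM ω) x y z + wedge12 0 0 x y z)
      = 0 * 0 + 1 * 0 + wedge12 (fun y => ThetaM ω X y + ξ y) (ThetaM ω) x y z
        + wedge12 0 0 x y z
    simp only [wedge12, wedge22, Pi.zero_apply]
    ring
  · intro x y z w
    change 0 + (0 * (PhiM ω).c4 x y z w + 1 * 0 + wedge13 ξ 0 x y z w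
        + wedge31 0 0 x y z w + wedge22 0 (ThetaM ω) x y z w)
      = 0 * (PhiM ω).c4 x y z w + 1 * 0 + wedge13 (fun y => ThetaM ω X y + ξ y) 0 x y z w
        + wedge31 0 0 x y z w + wedge22 0 (ThetaM ω) x y z w
    simp [wedge13]

/-- `OmegaC X` as a complex 1-covector. -/
def OmegaCLinear (X : Vc) : Vc →ₗ[ℂ] ℂ where
  toFun := OmegaC X
  map_add' y z := by
    simp only [OmegaC, Pi.add_apply]
    ring
  map_smul' c y := by
    simp only [OmegaC, Pi.smul_apply, smul_eq_mul, RingHom.id_apply]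
    ring

/-- Nondegeneracy of the complexified symplectic form: every 1-covector is a contraction. -/
theorem exists_OmegaC_eq (α : Vc →ₗ[ℂ] ℂ) : ∃ X : Vc, ∀ y, OmegaC X y = α y := by
  refine ⟨![α (ec 2), α (ec 3), -α (ec 0), -α (ec 1)], fun y => ?_⟩
  have h : α y = ∑ i, y i * α (ec i) := by
    conv_lhs => rw [← Finset.univ_sum_single y, map_sum]
    refine Finset.sum_congr rfl fun i _ => ?_
    rw [← smul_eq_mul, ← map_smul, ec, ← Pi.single_smul, smul_eq_mul, mul_one]
  rw [h, Fin.sum_univ_four]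
  simp [OmegaC]
  ring

/-- `ρ(X - ι_X conj Θ)(Φ) = -2i (ι_XΩ) ∧ Φ`, and the image of
`Λ¹(conj E)` under the spin action applied to `Φ` is exactly `{α ∧ Φ}` for `α` a
complex 1-covector. -/
theorem spin_conj_action_on_Phi (ω : V → V → ℝ) (hω : IsAlt2 ω) :
    (∀ X : Vc, rhoM X (fun y => -(conj2 (ThetaM ω) X y)) (PhiM ω)
        = (-2 * Complex.I) • wedgeM (oneM fun y => OmegaC X y) (PhiM ω))
    ∧ (Set.range fun X : Vc => rhoM X (fun y => -(conj2 (ThetaM ω) X y)) (PhiM ω))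
        = {A : Mixed | ∃ α : Vc →ₗ[ℂ] ℂ, A = wedgeM (oneM fun v => α v) (PhiM ω)} := by
  have key (X : Vc) : rhoM X (fun y => -(conj2 (ThetaM ω) X y)) (PhiM ω)
      = (-2 * Complex.I) • wedgeM (oneM fun y => OmegaC X y) (PhiM ω) := by
    rw [rhoM_PhiM, smul_wedgeM_oneM]
    congr 2
    funext y
    rw [conj2_ThetaM]
    ring
  refine ⟨key, Set.ext fun A => ⟨?_, ?_⟩⟩
  · rintro ⟨X, rfl⟩
    refine ⟨(-2 * Complex.I) • OmegaCLinear X, ?_⟩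
    exact (key X).trans (smul_wedgeM_oneM _ _ _)
  · rintro ⟨α, rfl⟩
    obtain ⟨X, hX⟩ := exists_OmegaC_eq ((-2 * Complex.I)⁻¹ • α)
    refine ⟨X, (key X).trans ?_⟩
    rw [smul_wedgeM_oneM]
    congr 2
    funext y
    rw [hX, LinearMap.smul_apply, smul_eq_mul, mul_inv_cancel_left₀ (by simp)]

end
end

section
/- Let ω be an alternating 2-form on ℝ⁴, Θ = ω − iΩ and Φ = exp(Θ) = 1 + Θ + ½Θ∧Θ. For X, Y ∈ ℂ⁴ put α = ι_XΩ and β = ι_YΩ. Then ρ(X − ι_X conj(Θ))(ρ(Y − ι_Y conj(Θ))(Φ)) = −2i·(β(X) − 2i·α∧β)∧Φ, where β(X) = Ω(Y,X), and one has ⊥(α∧β) = −β(X) = α(Y). -/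
noncomputable section

theorem cx2_eq_minors {ω : V → V → ℝ} (hω : IsAlt2 ω) (x y : Vc) :
    cx2 ω x y = ω (e 0) (e 1) * (x 0 * y 1 - x 1 * y 0) + ω (e 0) (e 2) * (x 0 * y 2 - x 2 * y 0)
      + ω (e 0) (e 3) * (x 0 * y 3 - x 3 * y 0) + ω (e 1) (e 2) * (x 1 * y 2 - x 2 * y 1)
      + ω (e 1) (e 3) * (x 1 * y 3 - x 3 * y 1) + ω (e 2) (e 3) * (x 2 * y 3 - x 3 * y 2) := by
  have hdiag : ∀ i, ω (e i) (e i) = 0 := fun i => by linarith [hω.antisymm (e i) (e i)]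
  simp only [cx2, Fin.sum_univ_four, hdiag, hω.antisymm (e 1) (e 0), hω.antisymm (e 2) (e 0),
    hω.antisymm (e 3) (e 0), hω.antisymm (e 2) (e 1), hω.antisymm (e 3) (e 1),
    hω.antisymm (e 3) (e 2)]
  push_cast
  ring

/-- The square of a 2-form on `ℂ⁴` is twice its Pfaffian times the determinant. -/
theorem wedge22_ThetaM_self {ω : V → V → ℝ} (hω : IsAlt2 ω) :
    ∃ c : ℂ, ∀ x y z w : Vc,
      wedge22 (ThetaM ω) (ThetaM ω) x y z w = c * (Matrix.of ![x, y, z, w]).det := by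
  refine ⟨2 * (ω (e 0) (e 1) * ω (e 2) (e 3)
    - (ω (e 0) (e 2) - Complex.I) * (ω (e 1) (e 3) - Complex.I)
    + ω (e 0) (e 3) * ω (e 1) (e 2)), fun x y z w => ?_⟩
  simp only [wedge22, ThetaM, cx2_eq_minors hω, OmegaC]
  simp [Matrix.det_succ_row_zero, Fin.sum_univ_succ, Fin.succAbove]
  ring

/-- The wedge of a 1-form with a 4-form on `ℂ⁴` vanishes. -/
theorem OmegaC_wedge_det (Y v x y z w : Vc) :
    OmegaC Y v * (Matrix.of ![x, y, z, w]).det = OmegaC Y x * (Matrix.of ![v, y, z, w]).det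
      - OmegaC Y y * (Matrix.of ![v, x, z, w]).det + OmegaC Y z * (Matrix.of ![v, x, y, w]).det
      - OmegaC Y w * (Matrix.of ![v, x, y, z]).det := by
  simp [OmegaC, Matrix.det_succ_row_zero, Fin.sum_univ_succ, Fin.succAbove]
  ring

theorem OmegaC_wedge_ThetaM_sq {ω : V → V → ℝ} (hω : IsAlt2 ω) (Y v x y z w : Vc) :
    OmegaC Y v * wedge22 (ThetaM ω) (ThetaM ω) x y z w
      = wedge13 (OmegaC Y) (wedge22 (ThetaM ω) (ThetaM ω) v) x y z w := by
  obtain ⟨c, hc⟩ := wedge22_ThetaM_self hω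
  simp only [wedge13, hc]
  linear_combination c * OmegaC_wedge_det Y v x y z w

theorem perpTwoC_wedge11_OmegaC (X Y : Vc) :
    perpTwoC (wedge11 (fun t => OmegaC X t) (fun t => OmegaC Y t)) = OmegaC X Y := by
  simp [perpTwoC, wedge11, OmegaC, ec]
  ring

theorem Mixed.add_def (A B : Mixed) :
    A + B = ⟨A.c0 + B.c0, A.c1 + B.c1, A.c2 + B.c2, A.c3 + B.c3, A.c4 + B.c4⟩ := rfl

theorem Mixed.smul_def (c : ℂ) (A : Mixed) :
    c • A = ⟨c * A.c0, c • A.c1, c • A.c2, c • A.c3, c • A.c4⟩ := rfl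

/-- The first spin action: `ρ(Y - ι_Y conj Θ)(Φ) = -2i β ∧ Φ` with `β = ι_YΩ`. -/
theorem rhoM_conj_PhiM (ω : V → V → ℝ) (Y : Vc) :
    rhoM Y (fun u => -(conj2 (ThetaM ω) Y u)) (PhiM ω)
      = ⟨0, fun u => -2 * Complex.I * OmegaC Y u, 0,
          fun x y z => -2 * Complex.I * wedge12 (OmegaC Y) (ThetaM ω) x y z, 0⟩ := by
  apply Mixed.ext_components <;> intros <;>
    simp [rhoM, iotaM, wedgeM, oneM, PhiM, Mixed.add_def, conj2_ThetaM, wedge11, wedge12, wedge13,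
      wedge31, wedge22]
  ring

/-- the double spin action of `conj E` on `Φ`:
`ρ(X - ι_X conj Θ)(ρ(Y - ι_Y conj Θ)(Φ)) = -2i (β(X) - 2i α∧β) ∧ Φ`, with `α = ι_XΩ`,
`β = ι_YΩ`, `β(X) = Ω(Y,X)`, and `⊥(α∧β) = -β(X) = α(Y)`. -/
theorem spin_conj_double_action (ω : V → V → ℝ) (hω : IsAlt2 ω) (X Y : Vc) :
    rhoM X (fun u => -(conj2 (ThetaM ω) X u))
        (rhoM Y (fun u => -(conj2 (ThetaM ω) Y u)) (PhiM ω))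
      = (-2 * Complex.I) • wedgeM
          ⟨OmegaC Y X, 0,
            fun u v =>
              (-2 * Complex.I) * wedge11 (fun t => OmegaC X t) (fun t => OmegaC Y t) u v,
            0, 0⟩ (PhiM ω)
    ∧ perpTwoC (wedge11 (fun t => OmegaC X t) (fun t => OmegaC Y t)) = -(OmegaC Y X)
    ∧ perpTwoC (wedge11 (fun t => OmegaC X t) (fun t => OmegaC Y t)) = OmegaC X Y := by
  refine ⟨?_, ?_, perpTwoC_wedge11_OmegaC X Y⟩
  · rw [rhoM_conj_PhiM]
    apply Mixed.ext_components
    case h4 =>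
      intro x y z w
      have key := OmegaC_wedge_ThetaM_sq hω Y X x y z w
      simp [rhoM, iotaM, wedgeM, oneM, PhiM, Mixed.add_def, Mixed.smul_def, conj2_ThetaM,
        wedge11, wedge12, wedge13, wedge31, wedge22] at key ⊢
      linear_combination Complex.I * key
    all_goals
      intros
      simp [rhoM, iotaM, wedgeM, oneM, PhiM, Mixed.add_def, Mixed.smul_def, conj2_ThetaM,
        wedge11, wedge12]
    ring
  · rw [perpTwoC_wedge11_OmegaC]
    simp only [OmegaC]
    ring

end
end

section
/- Let ω = ω₀ + λΩ be a smooth closed differential 2-form on ℝ⁴ with ω₀(x) primitive at every point and λ a smooth function, and let B = λ·Id − A₀ be the associated field of endomorphisms. A smooth function f on ℝ⁴ is a generating function of the Monge-Ampère equation Δ_ω = 0 (i.e. there exists a smooth function g with d(fω + gΩ) = 0) if and only if d(df∘B) = 0. -/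
noncomputable section

theorem d1_apply_clm {η : V → V →L[ℝ] ℝ} {p : V} (hη : DifferentiableAt ℝ η p) (x y : V) :
    d1 (fun q v => η q v) p x y = fderiv ℝ η p x y - fderiv ℝ η p y x := by
  have h : ∀ v, fderiv ℝ (fun q => η q v) p = (fderiv ℝ η p).flip v := fun v => by
    ext w
    simp [fderiv_clm_apply hη (differentiableAt_const v)]
  simp [d1, h]

/-- Poincaré lemma on `ℝ⁴`: a smooth 1-form is exact iff it is closed. -/
theorem exists_fderiv_eq_iff_d1_eq_zero {η : V → V →L[ℝ] ℝ} (hη : ContDiff ℝ (⊤ : ℕ∞) η) :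
    (∃ g : V → ℝ, ContDiff ℝ (⊤ : ℕ∞) g ∧ ∀ p, fderiv ℝ g p = η p) ↔
      ∀ p x y, d1 (fun q v => η q v) p x y = 0 := by
  have hdiff : Differentiable ℝ η := hη.differentiable (by simp)
  constructor
  · rintro ⟨g, hg, hgη⟩ p x y
    have hgd : Differentiable ℝ g := hg.differentiable (by simp)
    rw [d1_apply_clm (hdiff p), sub_eq_zero]
    exact second_derivative_symmetric (fun q => hgη q ▸ (hgd q).hasFDerivAt)
      (hdiff p).hasFDerivAt x y
  · intro h
    obtain ⟨g, hg⟩ := convex_univ.exists_forall_hasFDerivAt_of_fderiv_symmetric isOpen_univ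
      hdiff.differentiableOn fun p _ x y =>
        sub_eq_zero.1 ((d1_apply_clm (hdiff p) x y).symm.trans (h p x y))
    have hfd : fderiv ℝ g = η := funext fun p => (hg p trivial).fderiv
    exact ⟨g, contDiff_infty_iff_fderiv.2
      ⟨fun p => (hg p trivial).differentiableAt, hfd ▸ hη⟩, fun p => congrFun hfd p⟩

/-- The vector `X` with `ι_X Ω = a`. -/
theorem exists_Omega_eq (a : V →L[ℝ] ℝ) : ∃ X : V, ∀ y, Omega X y = a y := by
  refine ⟨![a (e 2), a (e 3), -a (e 0), -a (e 1)], fun y => ?_⟩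
  have hy : y = ∑ i, y i • e i := by
    simpa [e] using pi_eq_sum_univ' y
  conv_rhs => rw [hy]
  simp [Omega, Fin.sum_univ_four]
  ring

/-- For `ω₀` primitive with associated endomorphism `A`, `a ∧ ω₀ = -(a ∘ A) ∧ Ω`. -/
theorem wedge12_eq_neg_wedge12_comp {ω₀ : V → V → ℝ} (halt : IsAlt2 ω₀)
    (hprim : ∀ x y z w, wedge22 ω₀ Omega x y z w = 0) {A : V → V}
    (hA : ∀ X Y, ω₀ X Y = Omega (A X) Y) (a : V →L[ℝ] ℝ) (x y z : V) :
    wedge12 a ω₀ x y z = -wedge12 (fun v => a (A v)) Omega x y z := by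
  obtain ⟨X, hX⟩ := exists_Omega_eq a
  have hΩ : ∀ u v, Omega u v = -Omega v u := fun u v => by simp only [Omega]; ring
  have hXA : ∀ v, ω₀ X v = a (A v) := fun v => by
    rw [halt.antisymm, hA, hΩ, neg_neg, hX]
  have h := hprim X x y z
  simp only [wedge22, hXA, hX] at h
  simp only [wedge12]
  linear_combination h

/-- Exterior multiplication by `Ω` is injective on 1-forms of `ℝ⁴`. -/
theorem eq_zero_of_wedge12_Omega_eq_zero {c : V →L[ℝ] ℝ}
    (h : ∀ x y z, wedge12 c Omega x y z = 0) : c = 0 := by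
  have h0 := h (e 0) (e 1) (e 3)
  have h1 := h (e 1) (e 0) (e 2)
  have h2 := h (e 2) (e 1) (e 3)
  have h3 := h (e 3) (e 0) (e 2)
  simp [wedge12, Omega, e] at h0 h1 h2 h3
  ext y
  have hy : y = ∑ i, y i • e i := by
    simpa [e] using pi_eq_sum_univ' y
  rw [hy]
  simp [Fin.sum_univ_four, e, h0, h1, h2, h3]

/-- A vector field `A` is smooth as soon as all the functions `Ω(A, y)` are. -/
theorem contDiff_of_Omega {A : V → V}
    (hA : ∀ y, ContDiff ℝ (⊤ : ℕ∞) fun p => Omega (A p) y) :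
    ContDiff ℝ (⊤ : ℕ∞) A := by
  rw [contDiff_pi]
  have h0 := hA (e 2)
  have h1 := hA (e 3)
  have h2 := (hA (e 0)).neg
  have h3 := (hA (e 1)).neg
  simp [Omega, e] at h0 h1 h2 h3
  intro i
  fin_cases i <;> assumption

theorem d2_smul_add_smul {ω : V → V → V → ℝ} {f g : V → ℝ} {p : V}
    (hω : ∀ x y, DifferentiableAt ℝ (fun q => ω q x y) p)
    (hf : DifferentiableAt ℝ f p) (hg : DifferentiableAt ℝ g p) (x y z : V) :
    d2 (fun q u v => f q * ω q u v + g q * Omega u v) p x y z =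
      wedge12 (fderiv ℝ f p) (ω p) x y z + f p * d2 ω p x y z
        + wedge12 (fderiv ℝ g p) Omega x y z := by
  have h : ∀ u v, fderiv ℝ (fun q => f q * ω q u v + g q * Omega u v) p =
      f p • fderiv ℝ (fun q => ω q u v) p + ω p u v • fderiv ℝ f p
        + Omega u v • fderiv ℝ g p := fun u v =>
    ((hf.hasFDerivAt.mul (hω u v).hasFDerivAt).add (hg.hasFDerivAt.mul_const _)).fderiv
  simp only [d2, wedge12, h, add_apply, smul_apply, smul_eq_mul]
  ring

/-- `f` is a generating function of `Δ_ω = 0` (there is a smooth `g`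
with `d(fω + gΩ) = 0`) iff `d(df∘B) = 0`. -/
theorem generating_function_iff_dBdf_eq_zero (ω₀ : V → V → V → ℝ)
    (halt : ∀ p, IsAlt2 (ω₀ p)) (hsm : Smooth2 ω₀)
    (hprim : ∀ p x y z w : V, wedge22 (ω₀ p) Omega x y z w = 0)
    (lam : V → ℝ) (hlam : ContDiff ℝ (⊤ : ℕ∞) lam)
    (A₀ : V → (V →ₗ[ℝ] V)) (hA : ∀ p X Y, ω₀ p X Y = Omega (A₀ p X) Y)
    (B : V → (V →ₗ[ℝ] V)) (hB : ∀ p v, B p v = lam p • v - A₀ p v)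
    (ω : V → V → V → ℝ) (hω : ∀ p x y, ω p x y = ω₀ p x y + lam p * Omega x y)
    (hclosed : ∀ p x y z, d2 ω p x y z = 0)
    (f : V → ℝ) (hf : ContDiff ℝ (⊤ : ℕ∞) f) :
    (∃ g : V → ℝ, ContDiff ℝ (⊤ : ℕ∞) g ∧
        ∀ p x y z, d2 (fun q u v => f q * ω q u v + g q * Omega u v) p x y z = 0)
      ↔ ∀ p x y, d1 (fun q v => fderiv ℝ f q (B q v)) p x y = 0 := by
  have hAsm : ∀ x, ContDiff ℝ (⊤ : ℕ∞) fun q => A₀ q x := fun x =>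
    contDiff_of_Omega fun y => by simpa only [hA] using hsm x y
  have hBsm : ∀ x, ContDiff ℝ (⊤ : ℕ∞) fun q => B q x := fun x => by
    simp only [hB]
    exact (hlam.smul contDiff_const).sub (hAsm x)
  have hωd : ∀ p x y, DifferentiableAt ℝ (fun q => ω q x y) p := fun p x y => by
    simp only [hω]
    exact (((hsm x y).add (hlam.mul contDiff_const)).differentiable (by simp)) p
  have hfd : Differentiable ℝ f := hf.differentiable (by simp)
  set η : V → V →L[ℝ] ℝ := fun q => (fderiv ℝ f q).comp (B q).toContinuousLinearMap with hη
  have hηsm : ContDiff ℝ (⊤ : ℕ∞) η := contDiff_clm_apply_iff.2 fun x =>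
    (contDiff_infty_iff_fderiv.1 hf).2.clm_apply (hBsm x)
  have hwedge : ∀ p x y z, wedge12 (fderiv ℝ f p) (ω p) x y z = wedge12 (η p) Omega x y z := by
    intro p x y z
    have h := wedge12_eq_neg_wedge12_comp (halt p) (hprim p) (hA p) (fderiv ℝ f p) x y z
    simp only [wedge12] at h
    simp [wedge12, hη, hω, hB]
    linear_combination h
  have hd2 : ∀ g : V → ℝ, ContDiff ℝ (⊤ : ℕ∞) g → ∀ p x y z,
      d2 (fun q u v => f q * ω q u v + g q * Omega u v) p x y z =
        wedge12 (η p + fderiv ℝ g p) Omega x y z := by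
    intro g hg p x y z
    rw [d2_smul_add_smul (hωd p) (hfd p) (hg.differentiable (by simp) p), hwedge, hclosed]
    simp [wedge12]
    ring
  refine Iff.trans ⟨?_, ?_⟩ (exists_fderiv_eq_iff_d1_eq_zero hηsm)
  · rintro ⟨g, hg, h⟩
    refine ⟨fun q => -g q, hg.neg, fun p => ?_⟩
    have := eq_zero_of_wedge12_Omega_eq_zero fun x y z => (hd2 g hg p x y z).symm.trans (h p x y z)
    rw [fderiv_fun_neg, eq_neg_of_add_eq_zero_left this]
  · rintro ⟨g, hg, h⟩
    refine ⟨fun q => -g q, hg.neg, fun p x y z => ?_⟩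
    rw [hd2 _ hg.neg, fderiv_fun_neg, h]
    simp [wedge12]


end
end
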